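/- Fix β ∈ (−1,1). There exist C > 0 and Δ₀ > 0 such that for all α = 2−Δ with 0 < Δ < Δ₀, the mixed Fisher information of location and skewness satisfies |I_{μβ}(α)| ≤ C·Δ, where I_{μβ}(α) = ∫_ℝ (−f′(x;α,β))·f_β(x;α,β) / f(x;α,β) dx. -/

import Mathlib

open MeasureTheory Filter Set Topology Real

/-- Shift parameter ζ = −β·tan(πα/2) in Zolotarev's (M) parameterization. -/
noncomputable def zetaPar (α β : ℝ) : ℝ := -β * Real.tan (Real.pi * α / 2)

/-- Standard stable density in Zolotarev's (M) parameterization, via the inversion formula. -/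
noncomputable def stableDensity (α β x : ℝ) : ℝ :=
  (1 / Real.pi) *
    (∫ t in Set.Ioi (0 : ℝ),
      Complex.exp (-(Complex.I * (t : ℂ) * (x : ℂ))) *
        Complex.exp (-(((t ^ α : ℝ) : ℂ)) *
          (1 + Complex.I * (β : ℂ) * ((Real.tan (Real.pi * α / 2) : ℝ) : ℂ) *
            (((t ^ (1 - α) : ℝ) : ℂ) - 1)))).re

/-- The N(0,2) density f(y;2). -/
noncomputable def normalDensity (y : ℝ) : ℝ :=
  (1 / (2 * Real.sqrt Real.pi)) * Real.exp (-(y ^ 2) / 4)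

/-- Partial derivative of the stable density with respect to α. -/
noncomputable def fAlpha (α β x : ℝ) : ℝ := deriv (fun a : ℝ => stableDensity a β x) α

/-- Partial derivative of the stable density with respect to β. -/
noncomputable def fBeta (α β x : ℝ) : ℝ := deriv (fun b : ℝ => stableDensity α b x) β

/-- Derivative of the stable density in x. -/
noncomputable def fX (α β x : ℝ) : ℝ := deriv (stableDensity α β) x

/-- The scale score numerator f_σ = −f − x·f′. -/
noncomputable def fSig (α β x : ℝ) : ℝ := -stableDensity α β x - x * fX α β x


namespace StableFI

open Complex (I)

lemma exp_image : Real.exp '' Set.univ = Set.Ioi (0:ℝ) := by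
  rw [Set.image_univ, Real.range_exp]

lemma integral_exp_subst (g : ℝ → ℂ) :
    ∫ t in Set.Ioi (0:ℝ), g t = ∫ r : ℝ, ((Real.exp r : ℝ) : ℂ) * g (Real.exp r) := by
  rw [← exp_image, integral_image_eq_integral_abs_deriv_smul MeasurableSet.univ
    (fun x _ => (Real.hasDerivAt_exp x).hasDerivWithinAt) Real.exp_injective.injOn]
  simp [abs_of_pos (Real.exp_pos _)]

lemma bound_integrable {k p b : ℝ} (hk : 0 < k) (hp : 0 < p) (hb : 0 < b) :
    Integrable (fun r : ℝ => Real.exp (k * r) * Real.exp (-b * Real.exp (p * r))) := by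
  have h := integrableOn_rpow_mul_exp_neg_mul_rpow (p := p) (s := k - 1) (b := b)
    (by linarith) hp hb
  rw [← exp_image, integrableOn_image_iff_integrableOn_abs_deriv_smul MeasurableSet.univ
    (fun x _ => (Real.hasDerivAt_exp x).hasDerivWithinAt) Real.exp_injective.injOn,
    integrableOn_univ] at h
  refine h.congr (Eventually.of_forall fun r => ?_)
  simp only [abs_of_pos (Real.exp_pos _), smul_eq_mul]
  rw [← mul_assoc, ← Real.exp_mul, ← Real.exp_mul, ← Real.exp_add]
  ring_nf

lemma bound_tendsto_top {k p b : ℝ} (hp : 0 < p) (hb : 0 < b) :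
    Tendsto (fun r : ℝ => Real.exp (k * r) * Real.exp (-b * Real.exp (p * r))) atTop (𝓝 0) := by
  have h := tendsto_rpow_mul_exp_neg_mul_atTop_nhds_zero (k / p) b hb
  have h2 : Tendsto (fun r : ℝ => Real.exp (p * r)) atTop atTop :=
    Real.tendsto_exp_atTop.comp (tendsto_id.const_mul_atTop hp)
  refine (h.comp h2).congr fun r => ?_
  simp only [Function.comp]
  rw [← Real.exp_mul]
  congr 2
  field_simp

lemma bound_tendsto_bot {k p b : ℝ} (hk : 0 < k) (hb : 0 < b) :
    Tendsto (fun r : ℝ => Real.exp (k * r) * Real.exp (-b * Real.exp (p * r))) atBot (𝓝 0) := by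
  have h2 : Tendsto (fun r : ℝ => Real.exp (k * r)) atBot (𝓝 0) :=
    Real.tendsto_exp_atBot.comp (tendsto_id.const_mul_atBot hk)
  refine squeeze_zero (fun r => by positivity) (fun r => ?_) h2
  have : Real.exp (-b * Real.exp (p * r)) ≤ 1 := by
    rw [Real.exp_le_one_iff]; have := Real.exp_pos (p * r); nlinarith
  exact mul_le_of_le_one_right (Real.exp_pos _).le this

lemma strip_shift (H : ℂ → ℂ) (hH : Differentiable ℂ H) {k p b φ₁ φ₂ : ℝ}
    (hk : 0 < k) (hp : 0 < p) (hb : 0 < b) 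
    (hbd : ∀ r : ℝ, ∀ φ ∈ Set.uIcc φ₁ φ₂, ‖H (r + φ * I)‖ ≤
      Real.exp (k * r) * Real.exp (-b * Real.exp (p * r))) :
    ∫ r : ℝ, H (r + φ₁ * I) = ∫ r : ℝ, H (r + φ₂ * I) := by
  have hint : ∀ φ ∈ Set.uIcc φ₁ φ₂, Integrable (fun r : ℝ => H (r + φ * I)) := by
    intro φ hφ
    refine (bound_integrable hk hp hb).mono' ?_ (Eventually.of_forall fun r => hbd r φ hφ)
    have := hH.continuous
    exact Continuous.aestronglyMeasurable (by fun_prop)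
  have lim : ∀ φ ∈ Set.uIcc φ₁ φ₂, Tendsto (fun T : ℝ => ∫ r in (-T)..T, H (r + φ * I)) atTop
      (𝓝 (∫ r : ℝ, H (r + φ * I))) := fun φ hφ =>
    intervalIntegral_tendsto_integral (hint φ hφ) tendsto_neg_atTop_atBot tendsto_id
  have vert : ∀ (u : ℝ → ℝ) , 
      Tendsto (fun T => Real.exp (k * u T) * Real.exp (-b * Real.exp (p * u T))) atTop (𝓝 0) →
      Tendsto (fun T : ℝ => ∫ y in φ₁..φ₂, H (u T + y * I)) atTop (𝓝 0) := by
    intro u hu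
    have := hu.mul_const |φ₂ - φ₁|
    rw [zero_mul] at this
    refine squeeze_zero_norm (fun T => ?_) this
    refine intervalIntegral.norm_integral_le_of_norm_le_const fun y hy => ?_
    exact hbd _ _ (Set.uIoc_subset_uIcc hy)
  have v1 := vert (fun T => T) (bound_tendsto_top hp hb)
  have v2 := vert (fun T => -T) ((bound_tendsto_bot hk hb).comp tendsto_neg_atTop_atBot)
  have key : ∀ T : ℝ, (∫ r in (-T)..T, H (r + φ₂ * I)) = (∫ r in (-T)..T, H (r + φ₁ * I)) +
      I * (∫ y in φ₁..φ₂, H ((T : ℝ) + y * I)) - I * ∫ y in φ₁..φ₂, H ((-T : ℝ) + y * I) := by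
    intro T
    have := Complex.integral_boundary_rect_eq_zero_of_differentiableOn H ((-T : ℝ) + φ₁ * I)
      (T + φ₂ * I) hH.differentiableOn
    simp only [Complex.add_re, Complex.ofReal_re, Complex.mul_re, Complex.I_re, Complex.ofReal_im,
      Complex.I_im, Complex.add_im, Complex.mul_im, mul_zero, mul_one, sub_zero, zero_add, add_zero,
      smul_eq_mul, zero_mul, sub_self] at this
    linear_combination -this
  have l2 : Tendsto (fun T : ℝ => ∫ r in (-T)..T, H (r + φ₂ * I)) atTop
      (𝓝 (∫ r : ℝ, H (r + φ₁ * I))) := by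
    simp_rw [key]
    simpa using ((lim φ₁ Set.left_mem_uIcc).add (v1.const_mul I)).sub (v2.const_mul I)
  exact tendsto_nhds_unique l2 (lim φ₂ Set.right_mem_uIcc)


noncomputable def P (γ α : ℝ) (c : ℂ) (y : ℝ) : ℂ :=
  ∫ t in Set.Ioi (0:ℝ), ((t ^ γ : ℝ) : ℂ) *
    (Complex.exp (-(I * t * y)) * Complex.exp (-(c * ((t ^ α : ℝ) : ℂ))))

noncomputable def om (a : ℝ) : ℂ := Complex.exp (((-(a * (π / 6)) : ℝ) : ℂ) * I)

noncomputable def qi (γ α : ℝ) (c : ℂ) (y s : ℝ) : ℂ :=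
  ((s ^ γ : ℝ) : ℂ) *
    (Complex.exp (-(I * om 1 * s * y)) * Complex.exp (-(c * (om α * ((s ^ α : ℝ) : ℂ)))))

noncomputable def Q (γ α : ℝ) (c : ℂ) (y : ℝ) : ℂ := ∫ s in Set.Ioi (0:ℝ), qi γ α c y s

lemma norm_om (a : ℝ) : ‖om a‖ = 1 := Complex.norm_exp_ofReal_mul_I _

lemma re_ge {c : ℂ} (hc : c.re = 1) (hc2 : |c.im| ≤ 1 / 4) {ψ : ℝ} (h1 : |ψ| ≤ π / 3) :
    1 / 4 ≤ (c * Complex.exp ((ψ : ℂ) * I)).re := by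
  rw [Complex.mul_re, Complex.exp_ofReal_mul_I_re, Complex.exp_ofReal_mul_I_im, hc]
  have h2 : 1 / 2 ≤ Real.cos ψ := by
    rw [← Real.cos_abs, ← Real.cos_pi_div_three]
    exact Real.cos_le_cos_of_nonneg_of_le_pi (abs_nonneg _) (by linarith [Real.pi_pos]) h1
  have h3 : |c.im * Real.sin ψ| ≤ 1 / 4 := by
    rw [abs_mul]
    calc |c.im| * |Real.sin ψ| ≤ 1 / 4 * 1 := by
          gcongr; exact Real.abs_sin_le_one _
      _ = _ := by norm_num
  have := (abs_le.mp h3).2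
  linarith

lemma exp_strip (a r φ : ℝ) : Complex.exp ((a : ℂ) * (r + φ * I)) =
    ((Real.exp (a * r) : ℝ) : ℂ) * Complex.exp (((a * φ : ℝ) : ℂ) * I) := by
  rw [Complex.ofReal_exp, ← Complex.exp_add]
  congr 1
  push_cast
  ring

lemma exp_strip' (r φ : ℝ) : Complex.exp ((r : ℂ) + φ * I) =
    ((Real.exp r : ℝ) : ℂ) * Complex.exp ((φ : ℂ) * I) := by
  rw [Complex.ofReal_exp, ← Complex.exp_add]

lemma re_Iexp (r φ y : ℝ) : (-(I * y * Complex.exp ((r : ℂ) + φ * I))).re =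
    y * Real.exp r * Real.sin φ := by
  rw [exp_strip']
  simp [Complex.exp_ofReal_mul_I_re, Complex.exp_ofReal_mul_I_im, Complex.exp_ofReal_re]
  try ring

lemma rot {γ α : ℝ} {c : ℂ} {y : ℝ} (hc : c.re = 1) (hc2 : |c.im| ≤ 1 / 4) (hγ : 0 ≤ γ)
    (h1 : 1 ≤ α) (h2 : α ≤ 2) (hy : 0 ≤ y) : P γ α c y = om (1 + γ) * Q γ α c y := by
  have hpi := Real.pi_pos
  set H : ℂ → ℂ := fun z => Complex.exp (((γ + 1 : ℝ) : ℂ) * z) *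
    (Complex.exp (-(I * y * Complex.exp z)) * Complex.exp (-(c * Complex.exp ((α : ℂ) * z)))) with hH
  have hs := strip_shift H (by fun_prop) (k := γ + 1) (p := α) (b := 1 / 4) (φ₁ := 0)
    (φ₂ := -(π / 6)) (by linarith) (by linarith) (by norm_num) (by
      intro r φ hφ
      rw [Set.uIcc_of_ge (by linarith)] at hφ
      obtain ⟨hφ1, hφ2⟩ := hφ
      rw [hH]
      simp only [norm_mul, Complex.norm_exp]
      have e1 : (((γ + 1 : ℝ) : ℂ) * (r + φ * I)).re = (γ + 1) * r := by
        simp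
      rw [e1, re_Iexp]
      refine mul_le_mul_of_nonneg_left ?_ (Real.exp_pos _).le
      rw [← Real.exp_add, Real.exp_le_exp]
      have e2 : Real.sin φ ≤ 0 := Real.sin_nonpos_of_nonpos_of_neg_pi_le hφ2 (by linarith)
      have e3 : y * Real.exp r * Real.sin φ ≤ 0 :=
        mul_nonpos_of_nonneg_of_nonpos (by positivity) e2
      have e4 := re_ge hc hc2 (ψ := α * φ) (by
        rw [abs_le]; constructor <;> nlinarith)
      have e5 : (-(c * Complex.exp ((α : ℂ) * (r + φ * I)))).re =
          - (Real.exp (α * r) * (c * Complex.exp (((α * φ : ℝ) : ℂ) * I)).re) := by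
        rw [exp_strip, Complex.neg_re, ← mul_assoc, mul_comm c, mul_assoc, Complex.re_ofReal_mul]
      rw [e5]
      have := Real.exp_pos (α * r)
      nlinarith)
  unfold P Q
  rw [integral_exp_subst, integral_exp_subst, ← integral_const_mul]
  refine Eq.trans (integral_congr_ae (Eventually.of_forall fun r => ?_)) (hs.trans
    (integral_congr_ae (Eventually.of_forall fun r => ?_)).symm)
  · simp only [hH, Complex.ofReal_zero, zero_mul, add_zero]
    rw [← mul_assoc]
    congr 1
    · rw [← Real.exp_mul, ← Complex.ofReal_mul, ← Real.exp_add, ← Complex.ofReal_mul,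
        ← Complex.ofReal_exp]
      ring_nf
    · congr 2
      · push_cast; ring_nf
      · rw [← Real.exp_mul]; push_cast; ring_nf
  · simp only [hH, qi]
    rw [exp_strip, exp_strip, exp_strip', ← mul_assoc, ← mul_assoc]
    congr 1
    · have : om (1 + γ) = Complex.exp ((((γ + 1) * -(π / 6) : ℝ) : ℂ) * I) := by
        unfold om; congr 3; ring
      rw [this]
      have e : (Real.exp r) ^ γ = Real.exp (γ * r) := by rw [← Real.exp_mul]; ring_nf
      rw [e, add_mul γ 1 r, Real.exp_add]
      push_cast
      ring_nf
    · have o1 : om 1 = Complex.exp (((-(π / 6) : ℝ) : ℂ) * I) := by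
        unfold om; congr 3; ring
      have o2 : om α = Complex.exp (((α * -(π / 6) : ℝ) : ℂ) * I) := by
        unfold om; congr 3; ring
      rw [o1, o2]
      congr 2
      · ring_nf
      · have e : (Real.exp r) ^ α = Real.exp (α * r) := by rw [← Real.exp_mul]; ring_nf
        rw [e]; ring_nf

lemma rot_gamma {a y : ℝ} (ha : 0 ≤ a) (hy : 0 < y) :
    om (1 + a) * (∫ s in Set.Ioi (0:ℝ), ((s ^ a : ℝ) : ℂ) * Complex.exp (-(I * om 1 * s * y))) =
      Complex.exp (((-((1 + a) * (π / 2)) : ℝ) : ℂ) * I) *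
        (((1 / y) ^ (a + 1) * Real.Gamma (a + 1) : ℝ) : ℂ) := by
  have hpi := Real.pi_pos
  set H : ℂ → ℂ := fun z => Complex.exp (((a + 1 : ℝ) : ℂ) * z) *
    Complex.exp (-(I * y * Complex.exp z)) with hH
  have hs := strip_shift H (by fun_prop) (k := a + 1) (p := 1) (b := y / 2) (φ₁ := -(π / 6))
    (φ₂ := -(π / 2)) (by linarith) (by linarith) (by positivity) (by
      intro r φ hφ
      rw [Set.uIcc_of_ge (by linarith)] at hφ
      obtain ⟨hφ1, hφ2⟩ := hφ
      rw [hH]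
      simp only [norm_mul, Complex.norm_exp]
      have e1 : (((a + 1 : ℝ) : ℂ) * (r + φ * I)).re = (a + 1) * r := by
        simp
      rw [e1, re_Iexp]
      refine mul_le_mul_of_nonneg_left ?_ (Real.exp_pos _).le
      rw [Real.exp_le_exp]
      have e2 : Real.sin φ ≤ - (1 / 2) := by
        have : Real.sin (π / 6) ≤ Real.sin (-φ) :=
          Real.sin_le_sin_of_le_of_le_pi_div_two (by linarith) (by linarith) (by linarith)
        rw [Real.sin_pi_div_six, Real.sin_neg] at this
        linarith
      rw [one_mul]
      have := mul_pos hy (Real.exp_pos r)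
      nlinarith)
  rw [integral_exp_subst, ← integral_const_mul]
  have hG := Real.integral_rpow_mul_exp_neg_mul_Ioi (a := a + 1) (r := y) (by linarith) hy
  rw [← hG, ← integral_complex_ofReal, integral_exp_subst, ← integral_const_mul]
  have e : ∀ r, (Real.exp r) ^ a = Real.exp (a * r) := fun r => by
    rw [← Real.exp_mul]; ring_nf
  refine Eq.trans (integral_congr_ae (Eventually.of_forall fun r => ?_)) (hs.trans
    (integral_congr_ae (Eventually.of_forall fun r => ?_)).symm)
  · simp only [hH]
    rw [exp_strip, exp_strip', ← mul_assoc, ← mul_assoc]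
    congr 1
    · have : om (1 + a) = Complex.exp ((((a + 1) * -(π / 6) : ℝ) : ℂ) * I) := by
        unfold om; congr 3; ring
      rw [this, e, add_mul a 1 r, Real.exp_add]
      push_cast
      ring_nf
    · have o1 : om 1 = Complex.exp (((-(π / 6) : ℝ) : ℂ) * I) := by
        unfold om; congr 3; ring
      rw [o1]
      ring_nf
  · simp only [hH]
    rw [exp_strip, exp_strip']
    have e0 : Complex.exp (((-(π / 2) : ℝ) : ℂ) * I) = -I := by
      rw [Complex.ofReal_neg, neg_mul, Complex.exp_neg]
      rw [Complex.ofReal_div, Complex.ofReal_ofNat, Complex.exp_pi_div_two_mul_I, Complex.inv_I]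
    have e1 : (-((1 + a) * (π / 2)) : ℝ) = (a + 1) * -(π / 2) := by ring
    rw [e0, e1, add_sub_cancel_right, e, add_mul a 1 r, Real.exp_add]
    have e2 : -(I * y * (((Real.exp r : ℝ) : ℂ) * -I)) = ((-(y * Real.exp r) : ℝ) : ℂ) := by
      push_cast
      linear_combination (y * Complex.exp r) * Complex.I_mul_I
    rw [e2, ← Complex.ofReal_exp]
    push_cast
    ring_nf


lemma exp_diff {a b : ℂ} {m : ℝ} (ha : m ≤ a.re) (hb : m ≤ b.re) :
    ‖Complex.exp (-a) - Complex.exp (-b)‖ ≤ Real.exp (-m) * ‖a - b‖ := by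
  refine Convex.norm_image_sub_le_of_norm_hasDerivWithin_le (𝕜 := ℂ)
    (f := fun w : ℂ => Complex.exp (-w)) (f' := fun w => Complex.exp (-w) * (-1))
    (s := {w : ℂ | m ≤ w.re}) (fun w _ => ?_) (fun w hw => ?_) (convex_halfSpace_re_ge m) hb ha
  · exact ((hasDerivAt_id w).neg.cexp).hasDerivWithinAt
  · have hw' : m ≤ w.re := hw
    simp [Complex.norm_exp, hw']

lemma exp_diff2 {a b : ℂ} (ha : 0 ≤ a.re) (hb : 0 ≤ b.re) :
    ‖(Complex.exp (-a) - 1 + a) - (Complex.exp (-b) - 1 + b)‖ ≤ (‖a‖ + ‖b‖) * ‖a - b‖ := by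
  refine Convex.norm_image_sub_le_of_norm_hasDerivWithin_le (𝕜 := ℂ)
    (f := fun w : ℂ => Complex.exp (-w) - 1 + w) (f' := fun w => Complex.exp (-w) * (-1) + 1)
    (s := {w : ℂ | 0 ≤ w.re} ∩ Metric.closedBall 0 (‖a‖ + ‖b‖)) (fun w _ => ?_) (fun w hw => ?_)
    ((convex_halfSpace_re_ge 0).inter (convex_closedBall _ _)) ⟨hb, ?_⟩ ⟨ha, ?_⟩
  · exact ((((hasDerivAt_id w).neg.cexp).sub_const 1).add (hasDerivAt_id w)).hasDerivWithinAt
  · have hw1 : 0 ≤ w.re := hw.1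
    have hw2 : ‖w‖ ≤ ‖a‖ + ‖b‖ := by simpa using hw.2
    have h := exp_diff (a := w) (b := 0) (m := 0) hw1 (by simp)
    simp only [neg_zero, Complex.exp_zero, Real.exp_zero, one_mul, sub_zero] at h
    rw [norm_sub_rev] at h
    calc ‖Complex.exp (-w) * (-1) + 1‖ = ‖1 - Complex.exp (-w)‖ := by congr 1; ring
      _ ≤ _ := h.trans hw2
  · simp
  · simp

lemma rpow_mid {s p x q : ℝ} (hs : 0 < s) (h1 : p ≤ x) (h2 : x ≤ q) : s ^ x ≤ s ^ p + s ^ q := by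
  have hp := Real.rpow_pos_of_pos hs p
  have hq := Real.rpow_pos_of_pos hs q
  rcases le_total 1 s with h | h
  · have := Real.rpow_le_rpow_of_exponent_le h h2
    linarith
  · have := Real.rpow_le_rpow_of_exponent_ge hs h h1
    linarith

lemma pow_diff {s α : ℝ} (hs : 0 < s) (h1 : 3 / 2 ≤ α) (h2 : α ≤ 2) :
    |s ^ α - s ^ (2:ℝ)| ≤ 2 * (2 - α) * (s ^ (1:ℝ) + s ^ (3:ℝ)) := by
  have hp := Real.rpow_pos_of_pos hs 1
  have hq := Real.rpow_pos_of_pos hs 3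
  rcases le_total 1 s with h | h
  · have e0 : s ^ α ≤ s ^ (2:ℝ) := Real.rpow_le_rpow_of_exponent_le h h2
    have e1 : s ^ α = s ^ (2:ℝ) * s ^ (α - 2) := by rw [← Real.rpow_add hs]; ring_nf
    have e2 : 1 + Real.log s * (α - 2) ≤ s ^ (α - 2) := by
      rw [Real.rpow_def_of_pos hs]
      linarith [Real.add_one_le_exp (Real.log s * (α - 2))]
    have e3 : Real.log s ≤ s := (Real.log_le_sub_one_of_pos hs).trans (by linarith)
    have e4 : s ^ (3:ℝ) = s ^ (2:ℝ) * s := by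
      rw [← Real.rpow_add_one hs.ne']; norm_num
    have e5 := Real.rpow_pos_of_pos hs 2
    rw [abs_sub_comm, abs_of_nonneg (by linarith)]
    have e6 : s ^ (2:ℝ) - s ^ α ≤ s ^ (2:ℝ) * ((2 - α) * s) := by
      rw [e1]
      have : 1 - s ^ (α - 2) ≤ (2 - α) * s := by nlinarith
      have h3 := mul_le_mul_of_nonneg_left this e5.le
      rwa [mul_sub, mul_one] at h3
    have e7 : s ^ (2:ℝ) * ((2 - α) * s) = (2 - α) * s ^ (3:ℝ) := by rw [e4]; ring
    have e8 : 0 ≤ (2 - α) := by linarith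
    rw [e7] at e6
    have g1 := mul_nonneg e8 hp.le
    have g2 := mul_nonneg e8 hq.le
    linarith
  · have e0 : s ^ (2:ℝ) ≤ s ^ α := Real.rpow_le_rpow_of_exponent_ge hs h h2
    have e1 : s ^ (2:ℝ) = s ^ α * s ^ (2 - α) := by rw [← Real.rpow_add hs]; ring_nf
    have e2 : 1 + Real.log s * (2 - α) ≤ s ^ (2 - α) := by
      rw [Real.rpow_def_of_pos hs]
      linarith [Real.add_one_le_exp (Real.log s * (2 - α))]
    have e3 : -Real.log s ≤ 2 * s ^ (-(1/2) : ℝ) := by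
      have hpos := Real.rpow_pos_of_pos hs (-(1/2))
      have := Real.log_le_sub_one_of_pos hpos
      rw [Real.log_rpow hs] at this
      linarith
    have e5 := Real.rpow_pos_of_pos hs α
    have e8 : 0 ≤ (2 - α) := by linarith
    rw [abs_of_nonneg (by linarith)]
    have e6 : s ^ α - s ^ (2:ℝ) ≤ s ^ α * ((2 - α) * (2 * s ^ (-(1/2) : ℝ))) := by
      rw [e1]
      have : 1 - s ^ (2 - α) ≤ (2 - α) * (2 * s ^ (-(1/2) : ℝ)) := by nlinarith
      have h3 := mul_le_mul_of_nonneg_left this e5.le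
      rwa [mul_sub, mul_one] at h3
    have e7 : s ^ α * s ^ (-(1/2) : ℝ) ≤ s ^ (1:ℝ) := by
      rw [← Real.rpow_add hs]
      exact Real.rpow_le_rpow_of_exponent_ge hs h (by linarith)
    have e9 : s ^ α * ((2 - α) * (2 * s ^ (-(1/2) : ℝ))) = 2 * (2 - α) * (s ^ α * s ^ (-(1/2) : ℝ)) := by
      ring
    rw [e9] at e6
    nlinarith [mul_nonneg e8 hp.le, mul_nonneg e8 hq.le, mul_le_mul_of_nonneg_left e7 e8]

lemma om_diff {α : ℝ} (h2 : α ≤ 2) : ‖om α - om 2‖ ≤ 2 - α := by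
  have h := exp_diff (a := ((α * (π / 6) : ℝ) : ℂ) * I) (b := ((2 * (π / 6) : ℝ) : ℂ) * I) (m := 0)
    (by simp) (by simp)
  have e : ‖((α * (π / 6) : ℝ) : ℂ) * I - ((2 * (π / 6) : ℝ) : ℂ) * I‖ = (2 - α) * (π / 6) := by
    rw [← sub_mul, norm_mul, Complex.norm_I, mul_one, ← Complex.ofReal_sub, Complex.norm_real,
      Real.norm_eq_abs, abs_sub_comm, abs_of_nonneg]
    · ring
    · have := Real.pi_pos; nlinarith
  rw [e, neg_zero, Real.exp_zero, one_mul] at h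
  unfold om
  simp only [Complex.ofReal_neg, neg_mul] at h ⊢
  have := Real.pi_le_four
  nlinarith

lemma u_bound {s α : ℝ} {c : ℂ} (hs : 0 < s) (h1 : 3 / 2 ≤ α) (h2 : α ≤ 2) (hc : c.re = 1)
    (hc2 : |c.im| ≤ 4 * (2 - α)) :
    ‖c * (om α * ((s ^ α : ℝ) : ℂ)) - 1 * (om 2 * ((s ^ (2:ℝ) : ℝ) : ℂ))‖ ≤
      10 * (2 - α) * (s ^ (1:ℝ) + s ^ (3:ℝ)) := by
  have hd : 0 ≤ 2 - α := by linarith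
  have e : c * (om α * ((s ^ α : ℝ) : ℂ)) - 1 * (om 2 * ((s ^ (2:ℝ) : ℝ) : ℂ)) =
      (c - 1) * (om α * ((s ^ α : ℝ) : ℂ)) + om α * (((s ^ α - s ^ (2:ℝ) : ℝ)) : ℂ) +
      (om α - om 2) * ((s ^ (2:ℝ) : ℝ) : ℂ) := by push_cast; ring
  have hc1 : ‖c - 1‖ ≤ 4 * (2 - α) := by
    have : c - 1 = ((c.im : ℝ) : ℂ) * I := by
      apply Complex.ext <;> simp [hc]
    rw [this, norm_mul, Complex.norm_I, mul_one, Complex.norm_real]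
    exact hc2
  have n1 : ‖((s ^ α : ℝ) : ℂ)‖ ≤ s ^ (1:ℝ) + s ^ (3:ℝ) := by
    rw [Complex.norm_real, Real.norm_of_nonneg (Real.rpow_pos_of_pos hs _).le]
    exact rpow_mid hs (by linarith) (by linarith)
  have n2 : ‖((s ^ (2:ℝ) : ℝ) : ℂ)‖ ≤ s ^ (1:ℝ) + s ^ (3:ℝ) := by
    rw [Complex.norm_real, Real.norm_of_nonneg (Real.rpow_pos_of_pos hs _).le]
    exact rpow_mid hs (by norm_num) (by norm_num)
  have n3 : ‖(((s ^ α - s ^ (2:ℝ) : ℝ)) : ℂ)‖ ≤ 2 * (2 - α) * (s ^ (1:ℝ) + s ^ (3:ℝ)) := by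
    rw [Complex.norm_real]; exact pow_diff hs h1 h2
  have hX : 0 ≤ s ^ (1:ℝ) + s ^ (3:ℝ) := by positivity
  rw [e]
  refine (norm_add₃_le).trans ?_
  rw [norm_mul, norm_mul, norm_mul, norm_mul, norm_om, one_mul, one_mul]
  have m1 := mul_le_mul hc1 n1 (norm_nonneg _) (by positivity)
  have m2 := mul_le_mul (om_diff h2) n2 (norm_nonneg _) hd
  nlinarith [mul_nonneg hd hX]

lemma moment_integrable {k v : ℝ} (hk : -1 < k) (hv : 0 < v) :
    IntegrableOn (fun s : ℝ => s ^ k * Real.exp (-(v * s))) (Set.Ioi 0) := by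
  have := integrableOn_rpow_mul_exp_neg_mul_rpow (p := 1) (s := k) (b := v) hk one_pos hv
  simpa using this

lemma moment {k v : ℝ} (hk : -1 < k) (hv : 0 < v) :
    ∫ s in Set.Ioi (0:ℝ), s ^ k * Real.exp (-(v * s)) = (1 / v) ^ (k + 1) * Real.Gamma (k + 1) := by
  have := Real.integral_rpow_mul_exp_neg_mul_Ioi (a := k + 1) (r := v) (by linarith) hv
  simpa using this

lemma int_bound {f : ℝ → ℂ} {A v p q : ℝ} (hv : 0 < v) (hp : -1 < p) (hq : -1 < q)
    (h : ∀ s > 0, ‖f s‖ ≤ A * ((s ^ p + s ^ q) * Real.exp (-(v * s)))) :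
    ‖∫ s in Set.Ioi (0:ℝ), f s‖ ≤ A * ((1 / v) ^ (p + 1) * Real.Gamma (p + 1) +
      (1 / v) ^ (q + 1) * Real.Gamma (q + 1)) := by
  rw [← moment hp hv, ← moment hq hv, ← integral_add (moment_integrable hp hv)
    (moment_integrable hq hv), ← integral_const_mul]
  refine norm_integral_le_of_norm_le
    (((moment_integrable hp hv).add (moment_integrable hq hv)).const_mul A) ?_
  refine (ae_restrict_mem measurableSet_Ioi).mono fun s hs => ?_
  refine (h s hs).trans (le_of_eq ?_)
  ring


lemma om_one_im : (om 1).im = -(1 / 2) := by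
  unfold om
  rw [Complex.exp_ofReal_mul_I_im, one_mul, Real.sin_neg, Real.sin_pi_div_six]

lemma osc_norm (s y : ℝ) : ‖Complex.exp (-(I * om 1 * s * y))‖ = Real.exp (-(y / 2 * s)) := by
  rw [Complex.norm_exp]
  congr 1
  simp [om_one_im]
  ring

lemma re_lower' {s α : ℝ} {c : ℂ} (hs : 0 < s) (h1 : 1 ≤ α) (h2 : α ≤ 2) (hc : c.re = 1)
    (hc2 : |c.im| ≤ 1 / 4) : s ^ α / 4 ≤ (c * (om α * ((s ^ α : ℝ) : ℂ))).re := by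
  have hpi := Real.pi_pos
  have h := re_ge hc hc2 (ψ := -(α * (π / 6))) (by
    rw [abs_neg, abs_of_nonneg (by positivity)]; nlinarith)
  have e : (c * (om α * ((s ^ α : ℝ) : ℂ))).re = s ^ α * (c * om α).re := by
    rw [← mul_assoc, mul_comm, Complex.re_ofReal_mul]
  have h' : 1 / 4 ≤ (c * om α).re := h
  rw [e]
  have := Real.rpow_pos_of_pos hs α
  nlinarith

lemma re_lower {s α : ℝ} {c : ℂ} (hs : 0 < s) (h1 : 1 ≤ α) (h2 : α ≤ 2) (hc : c.re = 1)
    (hc2 : |c.im| ≤ 1 / 4) : (s - 1) / 4 ≤ (c * (om α * ((s ^ α : ℝ) : ℂ))).re := by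
  refine le_trans ?_ (re_lower' hs h1 h2 hc hc2)
  have := Real.rpow_pos_of_pos hs α
  rcases le_total 1 s with h | h
  · have := Real.rpow_le_rpow_of_exponent_le h h1
    rw [Real.rpow_one] at this
    linarith
  · linarith

lemma exp_two {s y : ℝ} (hs : 0 < s) (hy : 0 ≤ y) :
    Real.exp (-(y / 2 * s)) * Real.exp (-((s - 1) / 4)) ≤ 2 * Real.exp (-((1 + y) / 4 * s)) := by
  have h2 : Real.exp (1 / 4) ≤ 2 := by
    have h4 : Real.exp (1 / 4) ^ 4 = Real.exp 1 := by rw [← Real.exp_nat_mul]; norm_num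
    have := Real.exp_one_lt_d9
    by_contra hcon
    push Not at hcon
    have : (2:ℝ) ^ 4 < Real.exp (1 / 4) ^ 4 := pow_lt_pow_left₀ hcon (by norm_num) (by norm_num)
    rw [h4] at this
    linarith
  calc Real.exp (-(y / 2 * s)) * Real.exp (-((s - 1) / 4))
      ≤ Real.exp (1 / 4) * Real.exp (-((1 + y) / 4 * s)) := by
        rw [← Real.exp_add, ← Real.exp_add, Real.exp_le_exp]
        nlinarith [mul_nonneg hy hs.le]
    _ ≤ _ := by gcongr

lemma norm_qi {γ α y s : ℝ} {c : ℂ} (hs : 0 < s) (h1 : 1 ≤ α) (h2 : α ≤ 2) (hc : c.re = 1)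
    (hc2 : |c.im| ≤ 1 / 4) (hy : 0 ≤ y) :
    ‖qi γ α c y s‖ ≤ 2 * (s ^ γ * Real.exp (-((1 + y) / 4 * s))) := by
  unfold qi
  have hg := Real.rpow_pos_of_pos hs γ
  rw [norm_mul, norm_mul, osc_norm, Complex.norm_real, Real.norm_of_nonneg hg.le]
  have h3 : ‖Complex.exp (-(c * (om α * ((s ^ α : ℝ) : ℂ))))‖ ≤ Real.exp (-((s - 1) / 4)) := by
    rw [Complex.norm_exp, Real.exp_le_exp, Complex.neg_re, neg_le_neg_iff]
    exact re_lower hs h1 h2 hc hc2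
  have h4 := mul_le_mul_of_nonneg_left h3 (Real.exp_pos (-(y / 2 * s))).le
  have h5 := mul_le_mul_of_nonneg_left (h4.trans (exp_two hs hy)) hg.le
  linarith

lemma qi_meas (γ α y : ℝ) (c : ℂ) : Measurable (qi γ α c y) := by
  unfold qi
  fun_prop

lemma qi_int {γ α y : ℝ} {c : ℂ} (hγ : 0 ≤ γ) (h1 : 1 ≤ α) (h2 : α ≤ 2) (hc : c.re = 1)
    (hc2 : |c.im| ≤ 1 / 4) (hy : 0 ≤ y) : IntegrableOn (qi γ α c y) (Set.Ioi 0) := by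
  refine ((moment_integrable (k := γ) (v := (1 + y) / 4) (by linarith) (by linarith)).const_mul
    2).mono' (qi_meas _ _ _ _).aestronglyMeasurable ?_
  exact (ae_restrict_mem measurableSet_Ioi).mono fun s hs => norm_qi hs h1 h2 hc hc2 hy

lemma one_re_im : (1:ℂ).re = 1 ∧ |(1:ℂ).im| ≤ 1 / 4 := by norm_num

lemma Q_diff {γ : ℝ} (hγ : 0 ≤ γ) : ∃ K > 0, ∀ (α : ℝ) (c : ℂ) (y : ℝ), 3 / 2 ≤ α → α ≤ 2 →
    c.re = 1 → |c.im| ≤ 1 / 4 → |c.im| ≤ 4 * (2 - α) → 0 ≤ y →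
    ‖Q γ α c y - Q γ 2 1 y‖ ≤ K * (2 - α) * (1 + y) ^ (-(γ + 2)) := by
  have G1 : 0 < Real.Gamma (γ + 1 + 1) := Real.Gamma_pos_of_pos (by linarith)
  have G2 : 0 < Real.Gamma (γ + 3 + 1) := Real.Gamma_pos_of_pos (by linarith)
  refine ⟨20 * (4 ^ (γ + 1 + 1) * Real.Gamma (γ + 1 + 1) + 4 ^ (γ + 3 + 1) * Real.Gamma (γ + 3 + 1)),
    by positivity, ?_⟩
  intro α c y h1 h2 hc hc2 hc3 hy
  have hd : 0 ≤ 2 - α := by linarith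
  unfold Q
  rw [← integral_sub (qi_int hγ (by linarith) h2 hc hc2 hy)
    (qi_int hγ (by norm_num) le_rfl one_re_im.1 one_re_im.2 hy)]
  have hb := int_bound (f := fun s => qi γ α c y s - qi γ 2 1 y s) (A := 20 * (2 - α))
    (v := (1 + y) / 4) (p := γ + 1) (q := γ + 3) (by linarith) (by linarith) (by linarith) (by
      intro s hs
      have hg := Real.rpow_pos_of_pos hs γ
      have e : qi γ α c y s - qi γ 2 1 y s = ((s ^ γ : ℝ) : ℂ) * (Complex.exp (-(I * om 1 * s * y)) *
        (Complex.exp (-(c * (om α * ((s ^ α : ℝ) : ℂ)))) -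
          Complex.exp (-(1 * (om 2 * ((s ^ (2:ℝ) : ℝ) : ℂ)))))) := by
        unfold qi; ring
      rw [e, norm_mul, norm_mul, osc_norm, Complex.norm_real, Real.norm_of_nonneg hg.le]
      have d := (exp_diff (re_lower hs (by linarith) h2 hc hc2)
        (re_lower hs (by norm_num) le_rfl one_re_im.1 one_re_im.2)).trans
        (mul_le_mul_of_nonneg_left (u_bound hs h1 h2 hc hc3) (Real.exp_pos _).le)
      have X : 0 ≤ 10 * (2 - α) * (s ^ (1:ℝ) + s ^ (3:ℝ)) := by positivity
      calc s ^ γ * (Real.exp (-(y / 2 * s)) * _) ≤ s ^ γ * (Real.exp (-(y / 2 * s)) *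
            (Real.exp (-((s - 1) / 4)) * (10 * (2 - α) * (s ^ (1:ℝ) + s ^ (3:ℝ))))) := by gcongr
        _ = s ^ γ * ((Real.exp (-(y / 2 * s)) * Real.exp (-((s - 1) / 4))) *
            (10 * (2 - α) * (s ^ (1:ℝ) + s ^ (3:ℝ)))) := by ring
        _ ≤ s ^ γ * ((2 * Real.exp (-((1 + y) / 4 * s))) *
            (10 * (2 - α) * (s ^ (1:ℝ) + s ^ (3:ℝ)))) := by
              exact mul_le_mul_of_nonneg_left (mul_le_mul_of_nonneg_right (exp_two hs hy) X) hg.le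
        _ = _ := by rw [Real.rpow_add hs, Real.rpow_add hs]; ring)
  refine hb.trans ?_
  have hY : 1 ≤ 1 + y := by linarith
  have hdiv : 1 / ((1 + y) / 4) = 4 * (1 + y)⁻¹ := by field_simp
  have hpw : ∀ p : ℝ, (1 / ((1 + y) / 4)) ^ p = 4 ^ p * (1 + y) ^ (-p) := by
    intro p
    rw [hdiv, Real.mul_rpow (by norm_num) (by positivity), Real.inv_rpow (by positivity),
      Real.rpow_neg (by positivity)]
  rw [hpw, hpw]
  have q1 : (1 + y) ^ (-(γ + 1 + 1)) = (1 + y) ^ (-(γ + 2)) := by ring_nf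
  have q2 : (1 + y) ^ (-(γ + 3 + 1)) ≤ (1 + y) ^ (-(γ + 2)) :=
    Real.rpow_le_rpow_of_exponent_le hY (by linarith)
  rw [q1]
  have : 4 ^ (γ + 3 + 1) * (1 + y) ^ (-(γ + 3 + 1)) * Real.Gamma (γ + 3 + 1) ≤
    4 ^ (γ + 3 + 1) * (1 + y) ^ (-(γ + 2)) * Real.Gamma (γ + 3 + 1) := by gcongr
  calc _ ≤ 20 * (2 - α) * (4 ^ (γ + 1 + 1) * (1 + y) ^ (-(γ + 2)) * Real.Gamma (γ + 1 + 1) +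
        4 ^ (γ + 3 + 1) * (1 + y) ^ (-(γ + 2)) * Real.Gamma (γ + 3 + 1)) := by gcongr
    _ = _ := by ring

lemma Q_a : ∃ K > 0, ∀ (α : ℝ) (c : ℂ) (y : ℝ), 3 / 2 ≤ α → α ≤ 2 →
    c.re = 1 → |c.im| ≤ 1 / 4 → 0 ≤ y →
    ‖Q α α c y‖ ≤ K * (1 + y) ^ (-(5 / 2 : ℝ)) := by
  have G1 : 0 < Real.Gamma (3 / 2 + 1) := Real.Gamma_pos_of_pos (by norm_num)
  have G2 : 0 < Real.Gamma (2 + 1) := Real.Gamma_pos_of_pos (by norm_num)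
  refine ⟨2 * (4 ^ (3 / 2 + 1 : ℝ) * Real.Gamma (3 / 2 + 1) + 4 ^ (2 + 1 : ℝ) * Real.Gamma (2 + 1)),
    by positivity, ?_⟩
  intro α c y h1 h2 hc hc2 hy
  unfold Q
  have hb := int_bound (f := fun s => qi α α c y s) (A := 2)
    (v := (1 + y) / 4) (p := 3 / 2) (q := 2) (by linarith) (by linarith) (by linarith) (by
      intro s hs
      refine (norm_qi hs (by linarith) h2 hc hc2 hy).trans ?_
      gcongr
      exact rpow_mid hs h1 h2)
  refine hb.trans ?_
  have hY : 1 ≤ 1 + y := by linarith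
  have hdiv : 1 / ((1 + y) / 4) = 4 * (1 + y)⁻¹ := by field_simp
  have hpw : ∀ p : ℝ, (1 / ((1 + y) / 4)) ^ p = 4 ^ p * (1 + y) ^ (-p) := by
    intro p
    rw [hdiv, Real.mul_rpow (by norm_num) (by positivity), Real.inv_rpow (by positivity),
      Real.rpow_neg (by positivity)]
  rw [hpw, hpw]
  have q1 : (1 + y) ^ (-(3 / 2 + 1 : ℝ)) = (1 + y) ^ (-(5 / 2 : ℝ)) := by norm_num
  have q2 : (1 + y) ^ (-(2 + 1 : ℝ)) ≤ (1 + y) ^ (-(5 / 2 : ℝ)) :=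
    Real.rpow_le_rpow_of_exponent_le hY (by norm_num)
  rw [q1]
  calc _ ≤ 2 * (4 ^ (3 / 2 + 1 : ℝ) * (1 + y) ^ (-(5 / 2 : ℝ)) * Real.Gamma (3 / 2 + 1) +
        4 ^ (2 + 1 : ℝ) * (1 + y) ^ (-(5 / 2 : ℝ)) * Real.Gamma (2 + 1)) := by gcongr
    _ = _ := by ring


noncomputable def osc (a y s : ℝ) : ℂ := ((s ^ a : ℝ) : ℂ) * Complex.exp (-(I * om 1 * s * y))

lemma osc_int {a y : ℝ} (ha : 0 ≤ a) (hy : 0 < y) : IntegrableOn (osc a y) (Set.Ioi 0) := by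
  refine (moment_integrable (k := a) (v := y / 2) (by linarith) (by linarith)).mono' ?_ ?_
  · have : Measurable (osc a y) := by unfold osc; fun_prop
    exact this.aestronglyMeasurable
  · refine (ae_restrict_mem measurableSet_Ioi).mono fun s hs => ?_
    unfold osc
    rw [norm_mul, osc_norm, Complex.norm_real, Real.norm_of_nonneg (Real.rpow_pos_of_pos hs _).le]

lemma om_mul (a b : ℝ) : om a * om b = om (a + b) := by
  unfold om
  rw [← Complex.exp_add]
  congr 1
  push_cast
  ring

lemma rem_bound {s α : ℝ} {c : ℂ} (hs : 0 < s) (h1 : 3 / 2 ≤ α) (h2 : α ≤ 2) (hc : c.re = 1)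
    (hc2 : |c.im| ≤ 1 / 4) (hc3 : |c.im| ≤ 4 * (2 - α)) :
    ‖(Complex.exp (-(c * (om α * ((s ^ α : ℝ) : ℂ)))) - 1 + c * (om α * ((s ^ α : ℝ) : ℂ))) -
      (Complex.exp (-(1 * (om 2 * ((s ^ (2:ℝ) : ℝ) : ℂ)))) - 1 + 1 * (om 2 * ((s ^ (2:ℝ) : ℝ) : ℂ)))‖
      ≤ 120 * (2 - α) * (s ^ (5 / 2 : ℝ) + s ^ (5:ℝ)) := by
  have hd : 0 ≤ 2 - α := by linarith
  have a1 := Real.rpow_pos_of_pos hs α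
  have a2 := Real.rpow_pos_of_pos hs 2
  refine (exp_diff2 ((by positivity : 0 ≤ s ^ α / 4).trans (re_lower' hs (by linarith) h2 hc hc2))
    ((by positivity : 0 ≤ s ^ (2:ℝ) / 4).trans
      (re_lower' hs (by norm_num) le_rfl one_re_im.1 one_re_im.2))).trans ?_
  have hu := u_bound hs h1 h2 hc hc3
  have hcn : ‖c‖ ≤ 2 := by
    have := Complex.norm_le_abs_re_add_abs_im c
    rw [hc, abs_one] at this
    linarith
  have n1 : ‖c * (om α * ((s ^ α : ℝ) : ℂ))‖ ≤ 2 * s ^ α := by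
    rw [norm_mul, norm_mul, norm_om, one_mul, Complex.norm_real, Real.norm_of_nonneg a1.le]
    gcongr
  have n2 : ‖1 * (om 2 * ((s ^ (2:ℝ) : ℝ) : ℂ))‖ = s ^ (2:ℝ) := by
    rw [norm_mul, norm_mul, norm_om, one_mul, norm_one, one_mul, Complex.norm_real,
      Real.norm_of_nonneg a2.le]
  have m1 : s ^ α ≤ s ^ (3 / 2 : ℝ) + s ^ (2:ℝ) := rpow_mid hs h1 h2
  have m0 := Real.rpow_pos_of_pos hs (3 / 2)
  have n3 : ‖c * (om α * ((s ^ α : ℝ) : ℂ))‖ + ‖1 * (om 2 * ((s ^ (2:ℝ) : ℝ) : ℂ))‖ ≤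
      3 * (s ^ (3 / 2 : ℝ) + s ^ (2:ℝ)) := by rw [n2]; linarith
  refine (mul_le_mul n3 hu (norm_nonneg _) (by positivity)).trans ?_
  have e1 : s ^ (3 / 2 : ℝ) * s ^ (1:ℝ) = s ^ (5 / 2 : ℝ) := by
    rw [← Real.rpow_add hs]; norm_num
  have e2 : s ^ (3 / 2 : ℝ) * s ^ (3:ℝ) ≤ s ^ (5 / 2 : ℝ) + s ^ (5:ℝ) := by
    rw [← Real.rpow_add hs]; exact rpow_mid hs (by norm_num) (by norm_num)
  have e3 : s ^ (2 : ℝ) * s ^ (1:ℝ) ≤ s ^ (5 / 2 : ℝ) + s ^ (5:ℝ) := by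
    rw [← Real.rpow_add hs]; exact rpow_mid hs (by norm_num) (by norm_num)
  have e4 : s ^ (2 : ℝ) * s ^ (3:ℝ) = s ^ (5 : ℝ) := by
    rw [← Real.rpow_add hs]; norm_num
  have p1 := Real.rpow_pos_of_pos hs (5 / 2)
  have p2 := Real.rpow_pos_of_pos hs 5
  calc 3 * (s ^ (3 / 2 : ℝ) + s ^ (2:ℝ)) * (10 * (2 - α) * (s ^ (1:ℝ) + s ^ (3:ℝ)))
      = 30 * (2 - α) * (s ^ (3 / 2 : ℝ) * s ^ (1:ℝ) + s ^ (3 / 2 : ℝ) * s ^ (3:ℝ) +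
        s ^ (2 : ℝ) * s ^ (1:ℝ) + s ^ (2 : ℝ) * s ^ (3:ℝ)) := by ring
    _ ≤ 30 * (2 - α) * (4 * (s ^ (5 / 2 : ℝ) + s ^ (5:ℝ))) := by
        gcongr
        refine le_trans (add_le_add (add_le_add (add_le_add e1.le e2) e3) e4.le) ?_
        linarith
    _ = _ := by ring

lemma main_term : ∃ K > 0, ∀ (α : ℝ) (c : ℂ) (y : ℝ), 3 / 2 ≤ α → α ≤ 2 →
    c.re = 1 → |c.im| ≤ 1 / 4 → |c.im| ≤ 4 * (2 - α) → 1 ≤ y →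
    |(P 0 α c y).re - (P 0 2 1 y).re +
      (c * Complex.exp (((-((1 + α) * (π / 2)) : ℝ) : ℂ) * I)).re *
        ((1 / y) ^ (α + 1) * Real.Gamma (α + 1))| ≤ K * (2 - α) * y ^ (-(7 / 2 : ℝ)) := by
  have G1 : 0 < Real.Gamma (5 / 2 + 1) := Real.Gamma_pos_of_pos (by norm_num)
  have G2 : 0 < Real.Gamma (5 + 1) := Real.Gamma_pos_of_pos (by norm_num)
  refine ⟨120 * (2 ^ (5 / 2 + 1 : ℝ) * Real.Gamma (5 / 2 + 1) + 2 ^ (5 + 1 : ℝ) * Real.Gamma (5 + 1)),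
    by positivity, ?_⟩
  intro α c y h1 h2 hc hc2 hc3 hy
  have hd : 0 ≤ 2 - α := by linarith
  have hy0 : 0 < y := by linarith
  rw [rot hc hc2 le_rfl (by linarith) h2 hy0.le,
    rot one_re_im.1 one_re_im.2 le_rfl (by norm_num) le_rfl hy0.le]
  have ga := rot_gamma (a := α) (by linarith) hy0
  have g2 := rot_gamma (a := 2) (by norm_num) hy0
  set rem : ℝ → ℂ := fun s => (qi 0 α c y s - qi 0 2 1 y s) - (om 2 * osc 2 y s - c * om α * osc α y s)
    with hrem
  have hI : ∫ s in Set.Ioi (0:ℝ), rem s = (Q 0 α c y - Q 0 2 1 y) -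
      (om 2 * (∫ s in Set.Ioi (0:ℝ), osc 2 y s) - c * om α * ∫ s in Set.Ioi (0:ℝ), osc α y s) := by
    have i1 := qi_int (γ := 0) le_rfl (by linarith) h2 hc hc2 hy0.le
    have i2 := qi_int (γ := 0) le_rfl (by norm_num) le_rfl one_re_im.1 one_re_im.2 hy0.le
    have i3 := (osc_int (a := 2) (by norm_num) hy0).const_mul (om 2)
    have i4 := (osc_int (a := α) (by linarith) hy0).const_mul (c * om α)
    unfold Q
    rw [← integral_const_mul, ← integral_const_mul, ← integral_sub i1 i2, ← integral_sub i3 i4]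
    exact integral_sub (i1.sub i2) (i3.sub i4)
  have hb := int_bound (f := rem) (A := 120 * (2 - α)) (v := y / 2) (p := 5 / 2) (q := 5)
    (by linarith) (by norm_num) (by norm_num) (by
      intro s hs
      have e : rem s = Complex.exp (-(I * om 1 * s * y)) *
        ((Complex.exp (-(c * (om α * ((s ^ α : ℝ) : ℂ)))) - 1 + c * (om α * ((s ^ α : ℝ) : ℂ))) -
      (Complex.exp (-(1 * (om 2 * ((s ^ (2:ℝ) : ℝ) : ℂ)))) - 1 +
        1 * (om 2 * ((s ^ (2:ℝ) : ℝ) : ℂ)))) := by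
        simp only [hrem, qi, osc, Real.rpow_zero, Complex.ofReal_one]
        ring
      rw [e, norm_mul, osc_norm]
      have := mul_le_mul_of_nonneg_left (rem_bound hs h1 h2 hc hc2 hc3)
        (Real.exp_pos (-(y / 2 * s))).le
      linarith)
  have hdiv : 1 / (y / 2) = 2 * y⁻¹ := by field_simp
  have hpw : ∀ p : ℝ, (1 / (y / 2)) ^ p = 2 ^ p * y ^ (-p) := by
    intro p
    rw [hdiv, Real.mul_rpow (by norm_num) (by positivity), Real.inv_rpow (by positivity),
      Real.rpow_neg (by positivity)]
  rw [hpw, hpw] at hb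
  have q1 : y ^ (-(5 / 2 + 1 : ℝ)) = y ^ (-(7 / 2 : ℝ)) := by norm_num
  have q2 : y ^ (-(5 + 1 : ℝ)) ≤ y ^ (-(7 / 2 : ℝ)) :=
    Real.rpow_le_rpow_of_exponent_le hy (by norm_num)
  rw [q1] at hb
  have hb' : ‖∫ s in Set.Ioi (0:ℝ), rem s‖ ≤
      120 * (2 ^ (5 / 2 + 1 : ℝ) * Real.Gamma (5 / 2 + 1) + 2 ^ (5 + 1 : ℝ) * Real.Gamma (5 + 1)) *
      (2 - α) * y ^ (-(7 / 2 : ℝ)) := by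
    refine hb.trans ?_
    calc _ ≤ 120 * (2 - α) * (2 ^ (5 / 2 + 1 : ℝ) * y ^ (-(7 / 2 : ℝ)) * Real.Gamma (5 / 2 + 1) +
        2 ^ (5 + 1 : ℝ) * y ^ (-(7 / 2 : ℝ)) * Real.Gamma (5 + 1)) := by gcongr
      _ = _ := by ring
  refine le_trans ?_ hb'
  have hid : (om (1 + 0) * Q 0 α c y).re - (om (1 + 0) * Q 0 2 1 y).re +
      (c * Complex.exp (((-((1 + α) * (π / 2)) : ℝ) : ℂ) * I)).re *
        ((1 / y) ^ (α + 1) * Real.Gamma (α + 1)) = (om 1 * ∫ s in Set.Ioi (0:ℝ), rem s).re := by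
    rw [hI, add_zero]
    have z1 : om 1 * ((Q 0 α c y - Q 0 2 1 y) -
      (om 2 * (∫ s in Set.Ioi (0:ℝ), osc 2 y s) - c * om α * ∫ s in Set.Ioi (0:ℝ), osc α y s)) =
      om 1 * Q 0 α c y - om 1 * Q 0 2 1 y - om (1 + 2) * (∫ s in Set.Ioi (0:ℝ), osc 2 y s) +
      c * (om (1 + α) * (∫ s in Set.Ioi (0:ℝ), osc α y s)) := by
      rw [← om_mul, ← om_mul]; ring
    rw [z1]
    unfold osc
    rw [ga, g2, ← mul_assoc c]
    have z2 : (Complex.exp (((-((1 + 2) * (π / 2)) : ℝ) : ℂ) * I) *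
        (((1 / y) ^ ((2:ℝ) + 1) * Real.Gamma (2 + 1) : ℝ) : ℂ)).re = 0 := by
      rw [Complex.re_mul_ofReal, Complex.exp_ofReal_mul_I_re, Real.cos_neg]
      have : (1 + 2) * (π / 2) = π / 2 + π := by ring
      rw [this, Real.cos_add_pi, Real.cos_pi_div_two]
      simp
    rw [Complex.add_re, Complex.sub_re, Complex.sub_re, z2, Complex.re_mul_ofReal _ (_ * _)]
    ring
  rw [hid]
  refine (Complex.abs_re_le_norm _).trans ?_
  rw [norm_mul, norm_om, one_mul]


noncomputable def pint (γ α : ℝ) (c : ℂ) (y t : ℝ) : ℂ :=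
  ((t ^ γ : ℝ) : ℂ) *
    (Complex.exp (-(I * t * y)) * Complex.exp (-(c * ((t ^ α : ℝ) : ℂ))))

lemma norm_pint {γ α y t : ℝ} {c : ℂ} (hc : c.re = 1) (ht : 0 < t) :
    ‖pint γ α c y t‖ = t ^ γ * Real.exp (-1 * t ^ α) := by
  unfold pint
  rw [norm_mul, norm_mul, Complex.norm_real, Real.norm_of_nonneg (Real.rpow_pos_of_pos ht _).le,
    Complex.norm_exp, Complex.norm_exp]
  have e1 : (-(I * t * y)).re = 0 := by simp
  have e2 : (-(c * ((t ^ α : ℝ) : ℂ))).re = -1 * t ^ α := by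
    rw [Complex.neg_re, Complex.re_mul_ofReal, hc]; ring
  rw [e1, e2, Real.exp_zero, one_mul]

lemma pint_meas (γ α y : ℝ) (c : ℂ) : Measurable (pint γ α c y) := by
  unfold pint
  fun_prop

lemma pint_int {γ α y : ℝ} {c : ℂ} (hc : c.re = 1) (hγ : 0 ≤ γ) (hα : 0 < α) :
    IntegrableOn (pint γ α c y) (Set.Ioi 0) := by
  refine (integrableOn_rpow_mul_exp_neg_mul_rpow (p := α) (s := γ) (b := 1) (by linarith)
    hα one_pos).mono' (pint_meas _ _ _ _).aestronglyMeasurable ?_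
  exact (ae_restrict_mem measurableSet_Ioi).mono fun s hs => (norm_pint hc hs).le

lemma P_deriv {α κ η y₀ u₀ : ℝ} {c₀ : ℂ} (hα : 0 < α) (hc : c₀.re = 1) :
    HasDerivAt (fun u : ℝ => P 0 α (c₀ + ((u * κ : ℝ) : ℂ) * I) (y₀ + u * η))
      (-(I * η * P 1 α (c₀ + ((u₀ * κ : ℝ) : ℂ) * I) (y₀ + u₀ * η)) -
        I * κ * P α α (c₀ + ((u₀ * κ : ℝ) : ℂ) * I) (y₀ + u₀ * η)) u₀ := by
  have hc' : ∀ u : ℝ, (c₀ + ((u * κ : ℝ) : ℂ) * I).re = 1 := by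
    intro u; simp [hc]
  set F' : ℝ → ℝ → ℂ := fun u t => 
    -(I * η) * pint 1 α (c₀ + ((u * κ : ℝ) : ℂ) * I) (y₀ + u * η) t -
     I * κ * pint α α (c₀ + ((u * κ : ℝ) : ℂ) * I) (y₀ + u * η) t with hF'
  have i1 := integrableOn_rpow_mul_exp_neg_mul_rpow (p := α) (s := 1) (b := 1) (by linarith)
    hα one_pos
  have i2 := integrableOn_rpow_mul_exp_neg_mul_rpow (p := α) (s := α) (b := 1) (by linarith)
    hα one_pos
  have key := hasDerivAt_integral_of_dominated_loc_of_deriv_le (μ := volume.restrict (Set.Ioi 0))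
    (F := fun u t => pint 0 α (c₀ + ((u * κ : ℝ) : ℂ) * I) (y₀ + u * η) t) (F' := F')
    (x₀ := u₀) (s := Set.univ)
    (bound := fun t => |η| * (t ^ (1:ℝ) * Real.exp (-1 * t ^ α)) +
      |κ| * (t ^ α * Real.exp (-1 * t ^ α)))
    univ_mem
    (Eventually.of_forall fun u => (pint_meas _ _ _ _).aestronglyMeasurable)
    (pint_int (hc' _) le_rfl hα)
    (((pint_meas _ _ _ _).const_mul _).sub ((pint_meas _ _ _ _).const_mul _)).aestronglyMeasurable
    ((ae_restrict_mem measurableSet_Ioi).mono fun t ht u _ => by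
      refine (norm_sub_le _ _).trans ?_
      rw [norm_mul, norm_mul, norm_pint (hc' u) ht, norm_pint (hc' u) ht]
      simp)
    ((i1.const_mul _).add (i2.const_mul _))
    ((ae_restrict_mem measurableSet_Ioi).mono fun t ht u _ => by
      have ht' : (0:ℝ) < t := ht
      simp only [hF', pint, Real.rpow_zero, Real.rpow_one, Complex.ofReal_one, one_mul]
      have d1 : HasDerivAt (fun u : ℝ => -(I * t * ((y₀ + u * η : ℝ) : ℂ))) (-(I * t * η)) u := by
        have : HasDerivAt (fun u : ℝ => y₀ + u * η) η u := by
          simpa using ((hasDerivAt_id u).mul_const η).const_add y₀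
        exact ((this.ofReal_comp).const_mul _).neg
      have d2 : HasDerivAt (fun u : ℝ => -((c₀ + ((u * κ : ℝ) : ℂ) * I) * ((t ^ α : ℝ) : ℂ)))
          (-((κ : ℂ) * I * ((t ^ α : ℝ) : ℂ))) u := by
        have : HasDerivAt (fun u : ℝ => u * κ) κ u := by
          simpa using ((hasDerivAt_id u).mul_const κ)
        exact (((this.ofReal_comp.mul_const I).const_add c₀).mul_const _).neg
      refine (d1.cexp.mul d2.cexp).congr_deriv ?_
      ring)
  have k2 := key.2
  have e : ∫ t in Set.Ioi (0:ℝ), F' u₀ t = (-(I * η * P 1 α (c₀ + ((u₀ * κ : ℝ) : ℂ) * I) (y₀ + u₀ * η)) -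
        I * κ * P α α (c₀ + ((u₀ * κ : ℝ) : ℂ) * I) (y₀ + u₀ * η)) := by
    rw [hF']
    simp only
    rw [integral_sub ((pint_int (hc' _) zero_le_one hα).const_mul _)
      ((pint_int (hc' _) hα.le hα).const_mul _), integral_const_mul, integral_const_mul]
    simp only [pint, P]
    ring
  rw [e] at k2
  exact k2

lemma P_conj (γ α : ℝ) (c : ℂ) (y : ℝ) :
    P γ α (starRingEnd ℂ c) (-y) = starRingEnd ℂ (P γ α c y) := by
  unfold P
  rw [← integral_conj]
  congr 1
  ext t
  rw [map_mul, map_mul, ← Complex.exp_conj, ← Complex.exp_conj]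
  simp

lemma P_gauss (y : ℝ) : (P 0 2 1 y).re = Real.sqrt π / 2 * Real.exp (-(y ^ 2) / 4) := by
  have h := fourierIntegral_gaussian (b := 1) (by simp) (-(y:ℂ))
  have hi : Integrable (fun x : ℝ => Complex.exp (I * (-(y:ℂ)) * x) * Complex.exp (-1 * (x:ℂ) ^ 2)) := by
    have := integrable_cexp_quadratic' (b := -1) (by simp) (-(I * y)) 0
    refine this.congr (Eventually.of_forall fun x => ?_)
    simp only
    rw [← Complex.exp_add]; congr 1; ring
  have hre : (∫ x : ℝ, Complex.exp (I * (-(y:ℂ)) * x) * Complex.exp (-1 * (x:ℂ) ^ 2)).re =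
      ∫ x : ℝ, Real.cos (y * |x|) * Real.exp (-|x| ^ 2) := by
    rw [← Complex.reCLM_apply, ← Complex.reCLM.integral_comp_comm hi]
    congr 1
    ext x
    rw [Complex.reCLM_apply]
    have e1 : Complex.exp (-1 * (x:ℂ) ^ 2) = ((Real.exp (-|x| ^ 2) : ℝ) : ℂ) := by
      rw [Complex.ofReal_exp, sq_abs]; push_cast; ring_nf
    have e2 : I * (-(y:ℂ)) * x = ((-(y * x) : ℝ) : ℂ) * I := by push_cast; ring
    have e3 : Real.cos (y * |x|) = Real.cos (y * x) := by
      rcases abs_choice x with h | h <;> rw [h]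
      rw [mul_neg, Real.cos_neg]
    rw [e1, e2, Complex.re_mul_ofReal, Complex.exp_ofReal_mul_I_re, Real.cos_neg, e3]
  rw [integral_comp_abs (f := fun t => Real.cos (y * t) * Real.exp (-t ^ 2)), h] at hre
  have hP : (P 0 2 1 y).re = ∫ t in Set.Ioi (0:ℝ), Real.cos (y * t) * Real.exp (-t ^ 2) := by
    have hi2 := pint_int (γ := 0) (α := 2) (y := y) (c := 1) (by simp) le_rfl two_pos
    have : P 0 2 1 y = ∫ t in Set.Ioi (0:ℝ), pint 0 2 1 y t := rfl
    rw [this, ← Complex.reCLM_apply, ← Complex.reCLM.integral_comp_comm hi2]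
    congr 1
    ext t
    rw [Complex.reCLM_apply]
    unfold pint
    have e1 : Complex.exp (-(1 * ((t ^ (2:ℝ) : ℝ) : ℂ))) = ((Real.exp (-t ^ 2) : ℝ) : ℂ) := by
      rw [Complex.ofReal_exp, Real.rpow_two]; push_cast; ring_nf
    have e2 : -(I * t * y) = ((-(y * t) : ℝ) : ℂ) * I := by push_cast; ring
    rw [e1, e2, Real.rpow_zero, Complex.ofReal_one, one_mul, Complex.re_mul_ofReal,
      Complex.exp_ofReal_mul_I_re, Real.cos_neg]
  rw [← hP] at hre
  have hl : ((π / 1 : ℂ) ^ (1 / 2 : ℂ) * Complex.exp (-(-(y:ℂ)) ^ 2 / (4 * 1))) =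
      ((Real.sqrt π * Real.exp (-(y ^ 2) / 4) : ℝ) : ℂ) := by
    rw [Real.sqrt_eq_rpow, Complex.ofReal_mul, Complex.ofReal_cpow Real.pi_pos.le,
      Complex.ofReal_exp]
    push_cast
    ring_nf
  rw [hl, Complex.ofReal_re] at hre
  linarith

lemma P_deriv_y {α y : ℝ} {c : ℂ} (hα : 0 < α) (hc : c.re = 1) :
    HasDerivAt (fun u : ℝ => (P 0 α c u).re) (P 1 α c y).im y := by
  have h := P_deriv (κ := 0) (η := 1) (y₀ := 0) (u₀ := y) hα hc
  simp only [mul_zero, Complex.ofReal_zero, zero_mul, add_zero, mul_one, zero_add, sub_zero,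
    Complex.ofReal_one] at h
  have h2 := Complex.reCLM.hasFDerivAt.comp_hasDerivAt y h
  refine h2.congr_deriv ?_
  simp

lemma P1_gauss (y : ℝ) : (P 1 2 1 y).im = -(y / 2) * (Real.sqrt π / 2 * Real.exp (-(y ^ 2) / 4)) := by
  have h := P_deriv_y (α := 2) (y := y) (c := 1) two_pos (by simp)
  have h2 : HasDerivAt (fun u : ℝ => Real.sqrt π / 2 * Real.exp (-(u ^ 2) / 4))
      (-(y / 2) * (Real.sqrt π / 2 * Real.exp (-(y ^ 2) / 4))) y := by
    have h3 : HasDerivAt (fun u : ℝ => -(u ^ 2) / 4) (-(y / 2)) y := by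
      have := ((hasDerivAt_pow 2 y).neg).div_const 4
      refine this.congr_deriv ?_
      push_cast; ring
    refine (h3.exp.const_mul (Real.sqrt π / 2)).congr_deriv ?_
    ring
  simp_rw [P_gauss] at h
  exact h.unique h2

noncomputable def cc (κ : ℝ) : ℂ := 1 + (κ : ℂ) * I

lemma cc_re (κ : ℝ) : (cc κ).re = 1 := by simp [cc]
lemma cc_im (κ : ℝ) : (cc κ).im = κ := by simp [cc]

lemma density_eq {α τ : ℝ} (hτ : Real.tan (π * α / 2) = -τ) (b x : ℝ) :
    stableDensity α b x = (1 / π) * (P 0 α (cc (b * τ)) (x + b * (-τ))).re := by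
  unfold stableDensity P
  rw [hτ]
  congr 2
  refine setIntegral_congr_fun measurableSet_Ioi fun t ht => ?_
  have ht' : (0:ℝ) < t := ht
  simp only [Real.rpow_zero, Complex.ofReal_one, one_mul]
  rw [← Complex.exp_add, ← Complex.exp_add]
  congr 1
  have e : ((t ^ α : ℝ) : ℂ) * ((t ^ (1 - α) : ℝ) : ℂ) = t := by
    rw [← Complex.ofReal_mul, ← Real.rpow_add ht']; simp
  unfold cc
  push_cast
  linear_combination (I * b * τ) * e

lemma fX_eq {α τ : ℝ} (hα : 0 < α) (hτ : Real.tan (π * α / 2) = -τ) (b x : ℝ) :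
    fX α b x = (1 / π) * (P 1 α (cc (b * τ)) (x + b * (-τ))).im := by
  unfold fX
  have h : stableDensity α b = fun x => (1 / π) * (P 0 α (cc (b * τ)) (x + b * (-τ))).re := by
    ext x; exact density_eq hτ b x
  rw [h]
  have := (P_deriv_y (y := x + b * (-τ)) hα (cc_re (b * τ))).comp_add_const x (b * (-τ))
  exact (this.const_mul (1 / π)).deriv

lemma fBeta_eq {α τ : ℝ} (hα : 0 < α) (hτ : Real.tan (π * α / 2) = -τ) (b x : ℝ) :
    fBeta α b x = (1 / π) * (τ * (P α α (cc (b * τ)) (x + b * (-τ))).im -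
      τ * (P 1 α (cc (b * τ)) (x + b * (-τ))).im) := by
  unfold fBeta
  simp_rw [density_eq hτ]
  have h := P_deriv (α := α) (κ := τ) (η := -τ) (y₀ := x) (u₀ := b) (c₀ := 1) hα (by simp)
  have h2 := Complex.reCLM.hasFDerivAt.comp_hasDerivAt b h
  have h3 := (h2.const_mul (1 / π)).deriv
  refine Eq.trans ?_ (h3.trans ?_)
  · rfl
  · congr 1
    simp [cc]
    ring


lemma tan_facts {Δ : ℝ} (h0 : 0 < Δ) (h1 : Δ ≤ 1 / 16) :
    0 < Real.tan (π * Δ / 2) ∧ Real.tan (π * Δ / 2) ≤ 4 * Δ ∧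
    Real.tan (π * (2 - Δ) / 2) = -Real.tan (π * Δ / 2) ∧ Δ ≤ Real.sin (π * Δ / 2) ∧
    0 < Real.cos (π * Δ / 2) := by
  have hp := Real.pi_pos
  have hp3 := Real.pi_lt_d2
  have hx : 0 < π * Δ / 2 := by positivity
  have hxu : π * Δ / 2 ≤ 1.6 * Δ := by nlinarith
  have hxl : π * Δ / 2 ≤ 0.1 := by nlinarith
  have hc : 1 / 2 ≤ Real.cos (π * Δ / 2) := by
    have := Real.one_sub_sq_div_two_le_cos (x := π * Δ / 2)
    nlinarith
  have hs : Real.sin (π * Δ / 2) ≤ π * Δ / 2 := Real.sin_le hx.le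
  have hsl : Δ ≤ Real.sin (π * Δ / 2) := by
    have := Real.mul_le_sin hx.le (by nlinarith)
    have e : 2 / π * (π * Δ / 2) = Δ := by field_simp
    rwa [e] at this
  refine ⟨?_, ?_, ?_, hsl, by linarith⟩
  · rw [Real.tan_eq_sin_div_cos]
    exact div_pos (by linarith) (by linarith)
  · rw [Real.tan_eq_sin_div_cos, div_le_iff₀ (by linarith)]
    nlinarith
  · have e : π * (2 - Δ) / 2 = π - π * Δ / 2 := by ring
    rw [e, Real.tan_pi_sub]

lemma coef {Δ : ℝ} (b : ℝ) (hc : 0 < Real.cos (π * Δ / 2)) :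
    (cc (b * Real.tan (π * Δ / 2)) *
      Complex.exp (((-((1 + (2 - Δ)) * (π / 2)) : ℝ) : ℂ) * I)).re =
      -((1 + b) * Real.sin (π * Δ / 2)) := by
  rw [Complex.mul_re, Complex.exp_ofReal_mul_I_re, Complex.exp_ofReal_mul_I_im, cc_re, cc_im,
    Real.cos_neg, Real.sin_neg]
  have e : (1 + (2 - Δ)) * (π / 2) = (π / 2 - π * Δ / 2) + π := by ring
  rw [e, Real.cos_add_pi, Real.sin_add_pi, Real.cos_pi_div_two_sub, Real.sin_pi_div_two_sub,
    Real.tan_eq_sin_div_cos]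
  field_simp
  ring

lemma gamma_ge {a : ℝ} (ha : 2 ≤ a) : 1 ≤ Real.Gamma a := by
  have := Real.Gamma_strictMonoOn_Ici.monotoneOn (a := 2) (b := a) (by simp) (by simpa using ha) ha
  simpa [Real.Gamma_two] using this

noncomputable def gg (y : ℝ) : ℝ := Real.sqrt π / 2 * Real.exp (-(y ^ 2) / 4)

lemma gg_pos (y : ℝ) : 0 < gg y := by
  unfold gg
  have := Real.sqrt_pos.mpr Real.pi_pos
  positivity

lemma gg_anti {y M : ℝ} (hy : 0 ≤ y) (h : y ≤ M) : gg M ≤ gg y := by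
  unfold gg
  have := Real.sqrt_pos.mpr Real.pi_pos
  gcongr

lemma P_diff {γ : ℝ} (hγ : 0 ≤ γ) : ∃ K > 0, ∀ (α : ℝ) (c : ℂ) (y : ℝ), 3 / 2 ≤ α → α ≤ 2 →
    c.re = 1 → |c.im| ≤ 1 / 4 → |c.im| ≤ 4 * (2 - α) → 0 ≤ y →
    ‖P γ α c y - P γ 2 1 y‖ ≤ K * (2 - α) * (1 + y) ^ (-(γ + 2)) := by
  obtain ⟨K, hK, h⟩ := Q_diff hγ
  refine ⟨K, hK, fun α c y h1 h2 h3 h4 h5 h6 => ?_⟩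
  rw [rot h3 h4 hγ (by linarith) h2 h6,
    rot (c := 1) (by simp) (by simp) hγ (by norm_num) le_rfl h6, ← mul_sub, norm_mul, norm_om,
    one_mul]
  exact h α c y h1 h2 h3 h4 h5 h6

lemma gg_decay : ∃ K > 0, ∀ y : ℝ, 0 ≤ y → y / 2 * gg y ≤ K * (1 + y) ^ (-(5 / 2 : ℝ)) := by
  refine ⟨24 * Real.exp 2, by positivity, fun y hy => ?_⟩
  have hX : 0 < 1 + y := by linarith
  have h1 : (1 + y) ^ 4 / ((4).factorial : ℝ) ≤ Real.exp (1 + y) :=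
    Real.pow_div_factorial_le_exp _ hX.le 4
  have h2 : gg y ≤ Real.exp (1 - y) := by
    unfold gg
    have hs : Real.sqrt π ≤ 2 := by
      rw [Real.sqrt_le_left (by norm_num)]; linarith [Real.pi_le_four]
    have : Real.exp (-(y ^ 2) / 4) ≤ Real.exp (1 - y) := by
      apply Real.exp_le_exp.mpr; nlinarith [sq_nonneg (y - 2)]
    nlinarith [Real.exp_pos (-(y ^ 2) / 4)]
  have h3 : Real.exp (1 - y) * (1 + y) ^ 4 ≤ 24 * Real.exp 2 := by
    have h4 : (1 + y) ^ 4 ≤ 24 * Real.exp (1 + y) := by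
      have : ((4).factorial : ℝ) = 24 := by norm_num [Nat.factorial]
      rw [this] at h1; linarith
    calc Real.exp (1 - y) * (1 + y) ^ 4 ≤ Real.exp (1 - y) * (24 * Real.exp (1 + y)) := by gcongr
      _ = 24 * (Real.exp (1 - y) * Real.exp (1 + y)) := by ring
      _ = _ := by rw [← Real.exp_add]; ring_nf
  rw [Real.rpow_neg hX.le, ← div_eq_mul_inv, le_div_iff₀ (by positivity)]
  have h5 : (1 + y) ^ (5 / 2 : ℝ) ≤ (1 + y) ^ (3 : ℕ) := by
    rw [← Real.rpow_natCast]
    exact Real.rpow_le_rpow_of_exponent_le (by linarith) (by norm_num)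
  have hg := gg_pos y
  calc y / 2 * gg y * (1 + y) ^ (5 / 2 : ℝ)
      ≤ (1 + y) * Real.exp (1 - y) * (1 + y) ^ 3 := by
        gcongr; linarith
    _ = Real.exp (1 - y) * (1 + y) ^ 4 := by ring
    _ ≤ _ := h3

/-- common parameter facts -/
lemma par {Δ b : ℝ} (h0 : 0 < Δ) (h1 : Δ ≤ 1 / 16) (hb : |b| ≤ 1) :
    |(cc (b * Real.tan (π * Δ / 2))).im| ≤ 1 / 4 ∧
    |(cc (b * Real.tan (π * Δ / 2))).im| ≤ 4 * (2 - (2 - Δ)) := by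
  obtain ⟨t0, t1, -⟩ := tan_facts h0 h1
  rw [cc_im, abs_mul, abs_of_pos t0]
  have := abs_nonneg b
  constructor <;> nlinarith

lemma lower {δ : ℝ} (hδ : 0 < δ) : ∃ c₁ > 0, ∃ Δ₁ > 0, Δ₁ ≤ 1 / 16 ∧ ∀ Δ b y : ℝ, 0 < Δ → Δ < Δ₁ →
    |b| ≤ 1 - δ → 0 ≤ y →
    gg y / 2 ≤ (P 0 (2 - Δ) (cc (b * Real.tan (π * Δ / 2))) y).re ∧
    c₁ * Δ * (1 + y) ^ (-(3 : ℝ)) ≤ (P 0 (2 - Δ) (cc (b * Real.tan (π * Δ / 2))) y).re := by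
  obtain ⟨K, hK, hm⟩ := main_term
  obtain ⟨K0, hK0, hd⟩ := P_diff (γ := 0) le_rfl
  set M : ℝ := max 1 ((2 * K / δ) ^ 2) with hM
  have hgM := gg_pos M
  refine ⟨min (δ / 2) (gg M / 2), by positivity, min (1 / 16) (gg M / (2 * K0)), by positivity,
    min_le_left _ _, fun Δ b y h0 h1 hb hy => ?_⟩
  have hΔ : Δ ≤ 1 / 16 := h1.le.trans (min_le_left _ _)
  have hΔ2 : Δ ≤ gg M / (2 * K0) := h1.le.trans (min_le_right _ _)
  obtain ⟨t0, t1, t2, t3, t4⟩ := tan_facts h0 hΔ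
  obtain ⟨p1, p2⟩ := par (b := b) h0 hΔ (by linarith)
  have hX : 0 < 1 + y := by linarith
  have hX3 : 0 < (1 + y) ^ (-(3 : ℝ)) := Real.rpow_pos_of_pos hX _
  have hb' : δ ≤ 1 + b := by have := neg_abs_le b; linarith
  have hgy := gg_pos y
  rcases le_total y M with hyM | hyM
  · have h := hd (2 - Δ) (cc (b * Real.tan (π * Δ / 2))) y (by linarith) (by linarith) (cc_re _)
      p1 p2 hy
    have h' := (Complex.abs_re_le_norm _).trans h
    rw [Complex.sub_re, P_gauss] at h'
    change |_ - gg y| ≤ _ at h'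
    have e1 : (1 + y) ^ (-(0 + 2 : ℝ)) ≤ 1 :=
      Real.rpow_le_one_of_one_le_of_nonpos (by linarith) (by norm_num)
    have e2 : K0 * (2 - (2 - Δ)) * (1 + y) ^ (-(0 + 2 : ℝ)) ≤ K0 * Δ * 1 := by
      have : 2 - (2 - Δ) = Δ := by ring
      rw [this]; gcongr
    have e3 : K0 * Δ ≤ gg M / 2 := by
      rw [le_div_iff₀ (by positivity)] at hΔ2; linarith
    have e4 := gg_anti hy hyM
    have e5 := (neg_le_neg e2).trans (abs_le.mp h').1
    have e6 : (1 + y) ^ (-(3 : ℝ)) ≤ 1 :=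
      Real.rpow_le_one_of_one_le_of_nonpos (by linarith) (by norm_num)
    have e7 : min (δ / 2) (gg M / 2) * Δ * (1 + y) ^ (-(3 : ℝ)) ≤ gg M / 2 * 1 * 1 := by
      gcongr
      · exact min_le_right _ _
      · linarith
    clear h h' hm hd e2 e1 hX3
    constructor <;> linarith
  · have hy1 : 1 ≤ y := (le_max_left _ _).trans hyM
    have hy0 : 0 < y := by linarith
    have h := hm (2 - Δ) (cc (b * Real.tan (π * Δ / 2))) y (by linarith) (by linarith) (cc_re _)
      p1 p2 hy1
    rw [coef b t4, P_gauss] at h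
    change |_ - gg y + _| ≤ _ at h
    have e := (abs_le.mp h).1
    have e1 : (1 / y) ^ (3 : ℝ) ≤ (1 / y) ^ (2 - Δ + 1) * Real.Gamma (2 - Δ + 1) := by
      have a1 : (1 / y) ^ (3 : ℝ) ≤ (1 / y) ^ (2 - Δ + 1) := by
        apply Real.rpow_le_rpow_of_exponent_ge (by positivity)
        · rw [div_le_one hy0]; exact hy1
        · linarith
      have a2 : 1 ≤ Real.Gamma (2 - Δ + 1) := gamma_ge (by linarith)
      have a3 : 0 < (1 / y) ^ (2 - Δ + 1) := by positivity
      nlinarith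
    have e2 : (1 / y) ^ (3 : ℝ) = y ^ (-(3 : ℝ)) := by
      rw [one_div, Real.inv_rpow hy0.le, Real.rpow_neg hy0.le]
    have e3 : K * y ^ (-(7 / 2 : ℝ)) ≤ δ / 2 * y ^ (-(3 : ℝ)) := by
      have s1 : 2 * K / δ ≤ y ^ (1 / 2 : ℝ) := by
        rw [← Real.sqrt_eq_rpow]
        apply Real.le_sqrt_of_sq_le
        exact (le_max_right _ _).trans hyM
      have s2 : y ^ (-(3 : ℝ)) = y ^ (-(7 / 2 : ℝ)) * y ^ (1 / 2 : ℝ) := by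
        rw [← Real.rpow_add hy0]; norm_num
      have s3 : 0 < y ^ (-(7 / 2 : ℝ)) := Real.rpow_pos_of_pos hy0 _
      rw [div_le_iff₀ hδ] at s1
      rw [s2]
      nlinarith
    have e4 : (1 + y) ^ (-(3 : ℝ)) ≤ y ^ (-(3 : ℝ)) :=
      Real.rpow_le_rpow_of_nonpos hy0 (by linarith) (by norm_num)
    rw [e2] at e1
    have y3 : 0 < y ^ (-(3 : ℝ)) := Real.rpow_pos_of_pos hy0 _
    have e5 : δ * Δ * y ^ (-(3 : ℝ)) ≤ (1 + b) * Real.sin (π * Δ / 2) *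
        ((1 / y) ^ (2 - Δ + 1) * Real.Gamma (2 - Δ + 1)) := by
      have : 0 ≤ 1 + b := by linarith
      have : 0 ≤ (1 + b) * Real.sin (π * Δ / 2) := mul_nonneg this (by linarith)
      gcongr
    have e6 : K * (2 - (2 - Δ)) * y ^ (-(7 / 2 : ℝ)) ≤ δ / 2 * Δ * y ^ (-(3 : ℝ)) := by
      nlinarith
    have e7 : δ / 2 * Δ * (1 + y) ^ (-(3 : ℝ)) ≤ δ / 2 * Δ * y ^ (-(3 : ℝ)) := by gcongr
    have e8 : min (δ / 2) (gg M / 2) * Δ * (1 + y) ^ (-(3 : ℝ)) ≤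
        δ / 2 * Δ * (1 + y) ^ (-(3 : ℝ)) := by
      gcongr
      exact min_le_left _ _
    have e9 : 0 < δ / 2 * Δ * y ^ (-(3 : ℝ)) := by positivity
    constructor <;> linarith


lemma ptwise0 {δ : ℝ} (hδ : 0 < δ) : ∃ C > 0, ∃ Δ₁ > 0, Δ₁ ≤ 1 / 16 ∧ ∀ Δ b y : ℝ, 0 < Δ →
    Δ < Δ₁ → |b| ≤ 1 - δ → 0 ≤ y →
    |(P 1 (2 - Δ) (cc (b * Real.tan (π * Δ / 2))) y).im| *
      (Real.tan (π * Δ / 2) * (|(P (2 - Δ) (2 - Δ) (cc (b * Real.tan (π * Δ / 2))) y).im| +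
        |(P 1 (2 - Δ) (cc (b * Real.tan (π * Δ / 2))) y).im|)) /
      |(P 0 (2 - Δ) (cc (b * Real.tan (π * Δ / 2))) y).re| ≤
      C * Δ * (1 + y) ^ (-(3 / 2 : ℝ)) := by
  obtain ⟨c₁, hc₁, Δ₁, hΔ₁, hΔ₁', hl⟩ := lower hδ
  obtain ⟨K1, hK1, hd⟩ := P_diff (γ := 1) zero_le_one
  obtain ⟨Ka, hKa, ha⟩ := Q_a
  obtain ⟨Kg, hKg, hg⟩ := gg_decay
  refine ⟨(1 + K1 / c₁) * (4 * (Ka + (Kg + K1))), by positivity, Δ₁, hΔ₁, hΔ₁',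
    fun Δ b y h0 h1 hb hy => ?_⟩
  have hΔ : Δ ≤ 1 / 16 := h1.le.trans hΔ₁'
  obtain ⟨t0, t1, t2, t3, t4⟩ := tan_facts h0 hΔ
  obtain ⟨p1, p2⟩ := par (b := b) h0 hΔ (by linarith)
  obtain ⟨l1, l2⟩ := hl Δ b y h0 h1 hb hy
  have hd' := hd (2 - Δ) (cc (b * Real.tan (π * Δ / 2))) y (by linarith) (by linarith) (cc_re _)
      p1 p2 hy
  have hd2 := (Complex.abs_im_le_norm _).trans hd'
  rw [Complex.sub_im, P1_gauss] at hd2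
  change |_ - -(y / 2) * gg y| ≤ _ at hd2
  have ha' : |(P (2 - Δ) (2 - Δ) (cc (b * Real.tan (π * Δ / 2))) y).im| ≤
      Ka * (1 + y) ^ (-(5 / 2 : ℝ)) := by
    refine (Complex.abs_im_le_norm _).trans ?_
    rw [rot (cc_re _) p1 (by linarith) (by linarith) (by linarith) hy, norm_mul, norm_om, one_mul]
    exact ha (2 - Δ) _ y (by linarith) (by linarith) (cc_re _) p1 hy
  have hg' := hg y hy
  have hgy := gg_pos y
  set R := (P 0 (2 - Δ) (cc (b * Real.tan (π * Δ / 2))) y).re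
  set A := (P 1 (2 - Δ) (cc (b * Real.tan (π * Δ / 2))) y).im
  set B := |(P (2 - Δ) (2 - Δ) (cc (b * Real.tan (π * Δ / 2))) y).im|
  set τ := Real.tan (π * Δ / 2)
  have hX : 0 < 1 + y := by linarith
  have x3 : 0 < (1 + y) ^ (-(3 : ℝ)) := Real.rpow_pos_of_pos hX _
  have x5 : 0 < (1 + y) ^ (-(5 / 2 : ℝ)) := Real.rpow_pos_of_pos hX _
  have x35 : (1 + y) ^ (-(3 : ℝ)) ≤ (1 + y) ^ (-(5 / 2 : ℝ)) :=
    Real.rpow_le_rpow_of_exponent_le (by linarith) (by norm_num)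
  have x1 : (1 + y) * (1 + y) ^ (-(5 / 2 : ℝ)) = (1 + y) ^ (-(3 / 2 : ℝ)) := by
    nth_rewrite 1 [← Real.rpow_one (1 + y)]
    rw [← Real.rpow_add hX]; norm_num
  have hA : |A| ≤ y / 2 * gg y + K1 * Δ * (1 + y) ^ (-(3 : ℝ)) := by
    have e : K1 * (2 - (2 - Δ)) * (1 + y) ^ (-(1 + 2 : ℝ)) = K1 * Δ * (1 + y) ^ (-(3 : ℝ)) := by
      norm_num
    rw [e] at hd2
    have h2 : |A| ≤ |A - -(y / 2) * gg y| + |-(y / 2) * gg y| := by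
      have := abs_add_le (A - -(y / 2) * gg y) (-(y / 2) * gg y)
      simpa using this
    have h3 : |-(y / 2) * gg y| = y / 2 * gg y := by
      rw [neg_mul, abs_neg, abs_of_nonneg (by positivity)]
    linarith
  have hR : 0 < R := by linarith
  have hA1 : |A| ≤ (1 + K1 / c₁) * (1 + y) * R := by
    have q1 : y / 2 * gg y ≤ y * R := by nlinarith
    have q2 : K1 * Δ * (1 + y) ^ (-(3 : ℝ)) ≤ K1 / c₁ * R := by
      calc K1 * Δ * (1 + y) ^ (-(3 : ℝ)) = K1 / c₁ * (c₁ * Δ * (1 + y) ^ (-(3 : ℝ))) := by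
            field_simp
        _ ≤ _ := by gcongr
    have q3 : 0 ≤ K1 / c₁ * (y * R) := by positivity
    nlinarith
  have hA2 : |A| ≤ (Kg + K1) * (1 + y) ^ (-(5 / 2 : ℝ)) := by
    have q : K1 * Δ * (1 + y) ^ (-(3 : ℝ)) ≤ K1 * 1 * (1 + y) ^ (-(5 / 2 : ℝ)) := by
      gcongr; linarith
    linarith
  have hB : 0 ≤ B := abs_nonneg _
  rw [abs_of_pos hR, div_le_iff₀ hR]
  calc |A| * (τ * (B + |A|)) ≤ ((1 + K1 / c₁) * (1 + y) * R) *
        ((4 * Δ) * (Ka * (1 + y) ^ (-(5 / 2 : ℝ)) + (Kg + K1) * (1 + y) ^ (-(5 / 2 : ℝ)))) := by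
        gcongr
    _ = (1 + K1 / c₁) * (4 * (Ka + (Kg + K1))) * Δ * ((1 + y) * (1 + y) ^ (-(5 / 2 : ℝ))) * R := by
        ring
    _ = _ := by rw [x1]

lemma cc_conj (κ : ℝ) : starRingEnd ℂ (cc κ) = cc (-κ) := by
  simp [cc]

lemma ptwise {δ : ℝ} (hδ : 0 < δ) : ∃ C > 0, ∃ Δ₁ > 0, Δ₁ ≤ 1 / 16 ∧ ∀ Δ b y : ℝ, 0 < Δ →
    Δ < Δ₁ → |b| ≤ 1 - δ →
    |(P 1 (2 - Δ) (cc (b * Real.tan (π * Δ / 2))) y).im| *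
      (Real.tan (π * Δ / 2) * (|(P (2 - Δ) (2 - Δ) (cc (b * Real.tan (π * Δ / 2))) y).im| +
        |(P 1 (2 - Δ) (cc (b * Real.tan (π * Δ / 2))) y).im|)) /
      |(P 0 (2 - Δ) (cc (b * Real.tan (π * Δ / 2))) y).re| ≤
      C * Δ * (1 + ‖y‖) ^ (-(3 / 2 : ℝ)) := by
  obtain ⟨C, hC, Δ₁, h1, h2, h⟩ := ptwise0 hδ
  refine ⟨C, hC, Δ₁, h1, h2, fun Δ b y d0 d1 hb => ?_⟩
  rcases le_total 0 y with hy | hy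
  · rw [Real.norm_of_nonneg hy]
    exact h Δ b y d0 d1 hb hy
  · have := h Δ (-b) (-y) d0 d1 (by rwa [abs_neg]) (by linarith)
    rw [neg_mul, ← cc_conj, P_conj, P_conj, P_conj, Complex.conj_im, Complex.conj_im,
      Complex.conj_re, abs_neg, abs_neg] at this
    rw [Real.norm_of_nonpos hy]
    exact this

theorem final (β : ℝ) (hβ : β ∈ Set.Ioo (-1 : ℝ) 1) :
    ∃ C > (0 : ℝ), ∃ Δ₀ > (0 : ℝ), ∀ Δ : ℝ, 0 < Δ → Δ < Δ₀ →
      |∫ x : ℝ, (-fX (2 - Δ) β x) * fBeta (2 - Δ) β x / stableDensity (2 - Δ) β x| ≤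
        C * Δ := by
  have hb : |β| < 1 := abs_lt.mpr hβ
  obtain ⟨C, hC, Δ₁, h1, h2, h⟩ := ptwise (δ := 1 - |β|) (by linarith)
  have hi : Integrable (fun y : ℝ => (1 + ‖y‖) ^ (-(3 / 2 : ℝ))) :=
    integrable_one_add_norm (by norm_num)
  set J := ∫ y : ℝ, (1 + ‖y‖) ^ (-(3 / 2 : ℝ)) with hJ
  have hJ0 : 0 ≤ J := integral_nonneg fun y => by positivity
  refine ⟨C * J + 1, by positivity, Δ₁, h1, fun Δ d0 d1 => ?_⟩
  obtain ⟨t0, t1, t2, t3, t4⟩ := tan_facts d0 (d1.le.trans h2)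
  have hα : 0 < 2 - Δ := by linarith
  set s := β * (-Real.tan (π * Δ / 2)) with hs
  have hi2 : Integrable (fun x : ℝ => C * Δ * (1 + ‖x + s‖) ^ (-(3 / 2 : ℝ))) :=
    (hi.comp_add_right s).const_mul _
  have key := norm_integral_le_of_norm_le
    (f := fun x : ℝ => (-fX (2 - Δ) β x) * fBeta (2 - Δ) β x / stableDensity (2 - Δ) β x) hi2
    (Eventually.of_forall fun x => by
      have hp := h Δ β (x + s) d0 d1 (by linarith)
      refine le_trans ?_ hp
      rw [fX_eq hα t2, fBeta_eq hα t2, density_eq t2, ← hs, Real.norm_eq_abs]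
      set A := (P 1 (2 - Δ) (cc (β * Real.tan (π * Δ / 2))) (x + s)).im
      set B := (P (2 - Δ) (2 - Δ) (cc (β * Real.tan (π * Δ / 2))) (x + s)).im
      set R := (P 0 (2 - Δ) (cc (β * Real.tan (π * Δ / 2))) (x + s)).re
      set τ := Real.tan (π * Δ / 2)
      have e : -(1 / π * A) * (1 / π * (τ * B - τ * A)) / (1 / π * R) =
          (1 / π) * (-(A * (τ * (B - A)) / R)) := by
        have := Real.pi_pos.ne'
        by_cases hR : R = 0
        · simp [hR]
        · field_simp
      have hpi : 1 / π ≤ 1 := by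
        rw [div_le_one Real.pi_pos]; linarith [Real.pi_gt_three]
      rw [e, abs_mul, abs_of_pos (by positivity : 0 < 1 / π), abs_neg, abs_div, abs_mul, abs_mul,
        abs_of_pos t0]
      calc 1 / π * (|A| * (τ * |B - A|) / |R|) ≤ 1 * (|A| * (τ * (|B| + |A|)) / |R|) := by
            gcongr
            exact abs_sub _ _
        _ = _ := one_mul _)
  rw [Real.norm_eq_abs, integral_const_mul,
    integral_add_right_eq_self (fun y : ℝ => (1 + ‖y‖) ^ (-(3 / 2 : ℝ))) s, ← hJ] at key
  nlinarith


end StableFI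

theorem fisher_information_mu_beta (β : ℝ) (hβ : β ∈ Set.Ioo (-1 : ℝ) 1) :
    ∃ C > (0 : ℝ), ∃ Δ₀ > (0 : ℝ), ∀ Δ : ℝ, 0 < Δ → Δ < Δ₀ →
      |∫ x : ℝ, (-fX (2 - Δ) β x) * fBeta (2 - Δ) β x / stableDensity (2 - Δ) β x| ≤
        C * Δ := by
  exact StableFI.final β hβ
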